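/- For every n, the Tamari lattice Tₙ is (isomorphic to) a sublattice of the permutation lattice Sₙ: the map φ(E) = I_E is an injective map from bracketing functions to inversion sets of permutations that preserves binary meets and binary joins (the meet and join of Tₙ are sent to the meet and join of Sₙ). -/

import Mathlib

/-- The inversion set of a permutation `σ` of `Fin n`: pairs `(a, b)` with `a > b`
such that `a` precedes `b` in the word `σ(1) σ(2) ⋯ σ(n)`, i.e. `σ⁻¹ a < σ⁻¹ b`. -/
def InvSet (n : ℕ) (σ : Equiv.Perm (Fin n)) : Set (Fin n × Fin n) :=
  {p | p.2 < p.1 ∧ σ.symm p.1 < σ.symm p.2}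

/-- `A` is the inversion set of some permutation of `Fin n`. -/
def IsInvSet (n : ℕ) (A : Set (Fin n × Fin n)) : Prop :=
  ∃ σ : Equiv.Perm (Fin n), A = InvSet n σ

/-- Condition (I1): `A` is transitive. -/
def CondI1 {n : ℕ} (A : Set (Fin n × Fin n)) : Prop :=
  ∀ a b c : Fin n, (a, b) ∈ A → (b, c) ∈ A → (a, c) ∈ A

/-- Condition (I2): if `b < c < a` and `(a, b) ∈ A`, then `(a, c) ∈ A` or `(c, b) ∈ A`. -/
def CondI2 {n : ℕ} (A : Set (Fin n × Fin n)) : Prop :=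
  ∀ a b c : Fin n, b < c → c < a → (a, b) ∈ A → (a, c) ∈ A ∨ (c, b) ∈ A

/-- Condition (I2)*: if `b < c < a` and `(a, b) ∈ A`, then `(c, b) ∈ A`. -/
def CondI2Star {n : ℕ} (A : Set (Fin n × Fin n)) : Prop :=
  ∀ a b c : Fin n, b < c → c < a → (a, b) ∈ A → (c, b) ∈ A

/-- A bracketing function on `Fin n`: (E1) `k ≤ E k`, and
(E2) if `k ≤ j ≤ E k` then `E j ≤ E k`. -/
def IsBracketing {n : ℕ} (E : Fin n → Fin n) : Prop :=
  (∀ k, k ≤ E k) ∧ ∀ k j, k ≤ j → j ≤ E k → E j ≤ E k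

/-- The set of pairs `I_E = {(a, k) : k < a ≤ E k}` associated to a bracketing function. -/
def IE {n : ℕ} (E : Fin n → Fin n) : Set (Fin n × Fin n) :=
  {p | p.2 < p.1 ∧ p.1 ≤ E p.2}

/-- The transitive closure of a set of pairs. -/
def TrCl {n : ℕ} (A : Set (Fin n × Fin n)) : Set (Fin n × Fin n) :=
  {p | Relation.TransGen (fun a b => (a, b) ∈ A) p.1 p.2}

/-- Every strict total order on `Fin n` is realized by the positions of a permutation. -/
theorem exists_perm_symm_lt_iff {n : ℕ} (r : Fin n → Fin n → Prop)
    (irrefl : ∀ a, ¬ r a a) (trans : ∀ a b c, r a b → r b c → r a c)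
    (total : ∀ a b, a ≠ b → r a b ∨ r b a) :
    ∃ σ : Equiv.Perm (Fin n), ∀ a b, σ.symm a < σ.symm b ↔ r a b := by
  classical
  let pred (x : Fin n) : Finset (Fin n) := {y | r y x}
  have card_lt (x : Fin n) : (pred x).card < n := by
    have h : pred x ⊂ Finset.univ :=
      (Finset.ssubset_univ_iff).2 fun h => irrefl x (by
        have : x ∈ pred x := h ▸ Finset.mem_univ x
        simpa [pred] using this)
    simpa using Finset.card_lt_card h
  let pos (x : Fin n) : Fin n := ⟨(pred x).card, card_lt x⟩
  have mono (a b : Fin n) (hab : r a b) : pos a < pos b := by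
    refine Fin.mk_lt_mk.2 (Finset.card_lt_card ((Finset.ssubset_iff_of_subset ?_).2 ⟨a, ?_, ?_⟩))
    · intro y hy
      simp only [pred, Finset.mem_filter_univ] at hy ⊢
      exact trans y a b hy hab
    · simpa [pred] using hab
    · simpa [pred] using irrefl a
  have inj : Function.Injective pos := by
    intro a b hab
    by_contra hne
    rcases total a b hne with h | h
    · exact (mono a b h).ne hab
    · exact (mono b a h).ne hab.symm
  refine ⟨(Equiv.ofBijective pos (Finite.injective_iff_bijective.1 inj)).symm, fun a b => ?_⟩
  simp only [Equiv.symm_symm, Equiv.ofBijective_apply]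
  refine ⟨fun h => ?_, mono a b⟩
  have hne : a ≠ b := fun hab => h.ne (congrArg pos hab)
  exact (total a b hne).resolve_right fun hba => h.not_gt (mono b a hba)

theorem IsBracketing.isInvSet {n : ℕ} {E : Fin n → Fin n} (hE : IsBracketing E) :
    IsInvSet n (IE E) := by
  obtain ⟨h1, h2⟩ := hE
  obtain ⟨σ, hσ⟩ := exists_perm_symm_lt_iff
    (fun a b => (a < b ∧ E a < b) ∨ (b < a ∧ a ≤ E b)) (by simp)
    (by
      intro a b c hab hbc
      have := h1 a
      have := h1 b
      have := h1 c
      have := h2 a b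
      have := h2 a c
      have := h2 b a
      have := h2 b c
      have := h2 c a
      have := h2 c b
      rcases lt_trichotomy a c with h | rfl | h <;> grind)
    (by
      intro a b hab
      rcases lt_or_gt_of_ne hab with h | h <;> grind)
  refine ⟨σ, Set.ext fun ⟨a, b⟩ => ?_⟩
  simp only [IE, InvSet, Set.mem_ofPred_eq, hσ]
  grind

theorem IE_subset_IE_iff {n : ℕ} {E F : Fin n → Fin n} (hF : IsBracketing F) :
    IE E ⊆ IE F ↔ ∀ k, E k ≤ F k := by
  refine ⟨fun h k => ?_, fun h p hp => ⟨hp.1, hp.2.trans (h p.2)⟩⟩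
  rcases lt_or_ge k (E k) with hk | hk
  · exact (h (show (E k, k) ∈ IE E from ⟨hk, le_rfl⟩)).2
  · exact hk.trans (hF.1 k)

theorem IsBracketing.min {n : ℕ} {E F : Fin n → Fin n} (hE : IsBracketing E)
    (hF : IsBracketing F) : IsBracketing fun k => min (E k) (F k) :=
  ⟨fun k => le_min (hE.1 k) (hF.1 k), fun k j hkj hj =>
    min_le_min (hE.2 k j hkj (hj.trans (min_le_left _ _)))
      (hF.2 k j hkj (hj.trans (min_le_right _ _)))⟩

theorem IsInvSet.condI1 {n : ℕ} {C : Set (Fin n × Fin n)} (hC : IsInvSet n C) : CondI1 C := by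
  obtain ⟨σ, rfl⟩ := hC
  exact fun a b c hab hbc => ⟨hbc.1.trans hab.1, hab.2.trans hbc.2⟩

/-- A transitive set `C` of pairs contains a largest set of the form `IE H`. -/
theorem CondI1.exists_isBracketing {n : ℕ} {C : Set (Fin n × Fin n)} (hC : CondI1 C) :
    ∃ H : Fin n → Fin n, IsBracketing H ∧ IE H ⊆ C ∧
      ∀ E : Fin n → Fin n, IE E ⊆ C → ∀ k, E k ≤ H k := by
  classical
  let S (k : Fin n) : Finset (Fin n) := {h | ∀ a, k < a → a ≤ h → (a, k) ∈ C}
  have mem_S (k h : Fin n) : h ∈ S k ↔ ∀ a, k < a → a ≤ h → (a, k) ∈ C := by simp [S]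
  have self_mem (k : Fin n) : k ∈ S k :=
    (mem_S k k).2 fun a hka hak => absurd hka hak.not_gt
  let H (k : Fin n) : Fin n := (S k).max' ⟨k, self_mem k⟩
  have le_H (k h : Fin n) (hh : h ∈ S k) : h ≤ H k := Finset.le_max' _ _ hh
  have H_mem (k : Fin n) : ∀ a, k < a → a ≤ H k → (a, k) ∈ C :=
    (mem_S k (H k)).1 (Finset.max'_mem _ _)
  refine ⟨H, ⟨fun k => le_H k k (self_mem k), fun k j hkj hj => ?_⟩,
    fun p hp => H_mem p.2 p.1 hp.1 hp.2,
    fun E hE k => le_H k _ ((mem_S k _).2 fun a hka ha => hE ⟨hka, ha⟩)⟩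
  refine le_H k _ ((mem_S k _).2 fun a hka ha => ?_)
  rcases hkj.eq_or_lt with rfl | hlt
  · exact H_mem k a hka ha
  rcases le_or_gt a (H k) with hak | hak
  · exact H_mem k a hka hak
  · exact hC a j k (H_mem j a (hj.trans_lt hak) ha) (H_mem k j hlt hj)

/-- The Tamari lattice `Tₙ` is a sublattice of the permutation lattice `Sₙ`: the map
`φ(E) = I_E` maps bracketing functions to inversion sets, is injective, and sends meets
in `Tₙ` (pointwise greatest lower bounds among bracketing functions) to meets in `Sₙ`
and joins in `Tₙ` to joins in `Sₙ`. -/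
theorem stmt_15 (n : ℕ) :
    (∀ E : Fin n → Fin n, IsBracketing E → IsInvSet n (IE E)) ∧
    (∀ E F : Fin n → Fin n, IsBracketing E → IsBracketing F → IE E = IE F → E = F) ∧
    (∀ E F G : Fin n → Fin n, IsBracketing E → IsBracketing F → IsBracketing G →
      ((∀ k, G k ≤ E k) ∧ (∀ k, G k ≤ F k) ∧
        ∀ H : Fin n → Fin n, IsBracketing H → (∀ k, H k ≤ E k) → (∀ k, H k ≤ F k) →
          ∀ k, H k ≤ G k) →
      (IE G ⊆ IE E ∧ IE G ⊆ IE F ∧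
        ∀ C : Set (Fin n × Fin n), IsInvSet n C → C ⊆ IE E → C ⊆ IE F → C ⊆ IE G)) ∧
    (∀ E F G : Fin n → Fin n, IsBracketing E → IsBracketing F → IsBracketing G →
      ((∀ k, E k ≤ G k) ∧ (∀ k, F k ≤ G k) ∧
        ∀ H : Fin n → Fin n, IsBracketing H → (∀ k, E k ≤ H k) → (∀ k, F k ≤ H k) →
          ∀ k, G k ≤ H k) →
      (IE E ⊆ IE G ∧ IE F ⊆ IE G ∧
        ∀ C : Set (Fin n × Fin n), IsInvSet n C → IE E ⊆ C → IE F ⊆ C → IE G ⊆ C)) := by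
  refine ⟨fun E hE => hE.isInvSet, fun E F hE hF h => ?_, ?_, ?_⟩
  · exact funext fun k =>
      le_antisymm ((IE_subset_IE_iff hF).1 h.le k) ((IE_subset_IE_iff hE).1 h.ge k)
  · rintro E F G hE hF hG ⟨hGE, hGF, hmax⟩
    refine ⟨(IE_subset_IE_iff hE).2 hGE, (IE_subset_IE_iff hF).2 hGF,
      fun C _ hCE hCF p hp => ⟨(hCE hp).1, ?_⟩⟩
    exact (le_min (hCE hp).2 (hCF hp).2).trans
      (hmax _ (hE.min hF) (fun _ => min_le_left _ _) (fun _ => min_le_right _ _) p.2)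
  · rintro E F G hE hF hG ⟨hEG, hFG, hmin⟩
    refine ⟨(IE_subset_IE_iff hG).2 hEG, (IE_subset_IE_iff hG).2 hFG, fun C hC hEC hFC => ?_⟩
    obtain ⟨H, hH, hHC, hle⟩ := hC.condI1.exists_isBracketing
    exact ((IE_subset_IE_iff hH).2 (hmin H hH (hle E hEC) (hle F hFC))).trans hHC
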